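/- Let 𝔽_q be a finite field, Q ∈ 𝔽_q[t] a squarefree polynomial, and n an integer with 0 ≤ n < deg Q. Let α : 𝔽_q[t] → ℂ be even (α(cf) = α(f) for all c ∈ 𝔽_q^×) and satisfy |α(f)| ≤ A for all f ∈ M_n. Then |Var_Q(S_α) − (1/Φ(Q))·Σ_{f∈M_n, gcd(f,Q)=1} |α(f)|²| ≤ A²·q^{2n}/Φ(Q)². In particular Var_Q(S_α) = (q^n/Φ(Q))·⟨|α|²⟩_n·(1+O(1/q)) for n < deg Q. -/

import Mathlib

open Polynomial

/-- `S_α(A)`: the sum of `α` over monic polynomials of degree `n` in the residue class `A`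
modulo `Q`. -/
noncomputable def SapC {Fq : Type} [Field Fq] (Q : Fq[X]) (n : ℕ) (α : Fq[X] → ℂ)
    (A : Fq[X] ⧸ Ideal.span {Q}) : ℂ :=
  ∑ᶠ f ∈ {f : Fq[X] | f.Monic ∧ f.natDegree = n ∧ Ideal.Quotient.mk (Ideal.span {Q}) f = A},
    α f

/-- `Φ(Q)`: the number of invertible residue classes modulo `Q`. -/
noncomputable def PhiQ {Fq : Type} [Field Fq] (Q : Fq[X]) : ℕ :=
  {A : Fq[X] ⧸ Ideal.span {Q} | IsUnit A}.ncard

/-- The mean of `S_α` over invertible residue classes modulo `Q`. -/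
noncomputable def meanSapC {Fq : Type} [Field Fq] (Q : Fq[X]) (n : ℕ) (α : Fq[X] → ℂ) : ℂ :=
  (1 / (PhiQ Q : ℂ)) *
    ∑ᶠ A ∈ {A : Fq[X] ⧸ Ideal.span {Q} | IsUnit A}, SapC Q n α A

/-- The variance of `S_α` over invertible residue classes modulo `Q`. -/
noncomputable def varSapC {Fq : Type} [Field Fq] (Q : Fq[X]) (n : ℕ) (α : Fq[X] → ℂ) : ℝ :=
  (1 / (PhiQ Q : ℝ)) *
    ∑ᶠ A ∈ {A : Fq[X] ⧸ Ideal.span {Q} | IsUnit A},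
      ‖SapC Q n α A - meanSapC Q n α‖ ^ 2

theorem finite_quot_aux {Fq : Type} [Field Fq] [Fintype Fq] (Q : Fq[X]) (hQ0 : Q ≠ 0) :
    Finite (Fq[X] ⧸ Ideal.span {Q}) := by
  haveI : Module.Finite Fq (AdjoinRoot Q) := (AdjoinRoot.powerBasis hQ0).finite
  exact (Module.finite_of_finite Fq : Finite (AdjoinRoot Q))

theorem monic_aux {Fq : Type} [Field Fq] [Fintype Fq] (n : ℕ) :
    {f : Fq[X] | f.Monic ∧ f.natDegree = n}.Finite ∧
    {f : Fq[X] | f.Monic ∧ f.natDegree = n}.ncard ≤ Fintype.card Fq ^ n := by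
  have hinj : Set.InjOn (fun (f : Fq[X]) (i : Fin n) => f.coeff i)
      {f : Fq[X] | f.Monic ∧ f.natDegree = n} := by
    rintro f ⟨hf, hfn⟩ g ⟨hg, hgn⟩ h
    ext i
    rcases lt_trichotomy i n with hi | hi | hi
    · exact congrFun h ⟨i, hi⟩
    · have h1 : f.coeff n = 1 := by rw [← hfn]; exact hf
      have h2 : g.coeff n = 1 := by rw [← hgn]; exact hg
      rw [hi, h1, h2]
    · rw [coeff_eq_zero_of_natDegree_lt (by omega), coeff_eq_zero_of_natDegree_lt (by omega)]
  refine ⟨Set.Finite.of_finite_image (Set.toFinite _) hinj, ?_⟩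
  rw [← Set.ncard_image_of_injOn hinj]
  refine (Set.ncard_le_card _).trans ?_
  simp

theorem isUnit_mk_aux {Fq : Type} [Field Fq] (Q f : Fq[X]) :
    IsUnit (Ideal.Quotient.mk (Ideal.span {Q}) f) ↔ IsCoprime f Q := by
  rw [isUnit_iff_exists_inv]
  constructor
  · rintro ⟨b, hb⟩
    obtain ⟨g, rfl⟩ := Ideal.Quotient.mk_surjective b
    rw [← map_mul, ← map_one (Ideal.Quotient.mk (Ideal.span {Q})), Ideal.Quotient.eq,
      Ideal.mem_span_singleton] at hb
    obtain ⟨c, hc⟩ := hb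
    exact ⟨g, -c, by linear_combination hc⟩
  · rintro ⟨a, b, h⟩
    refine ⟨Ideal.Quotient.mk _ a, ?_⟩
    rw [← map_mul, ← map_one (Ideal.Quotient.mk (Ideal.span {Q})), Ideal.Quotient.eq,
      Ideal.mem_span_singleton]
    exact ⟨-b, by linear_combination h⟩

theorem mk_inj_aux {Fq : Type} [Field Fq] (Q : Fq[X]) (n : ℕ) (hn : n < Q.natDegree)
    {f g : Fq[X]} (_hf : f.Monic) (hfn : f.natDegree = n) (_hg : g.Monic) (hgn : g.natDegree = n)
    (h : Ideal.Quotient.mk (Ideal.span {Q}) f = Ideal.Quotient.mk (Ideal.span {Q}) g) :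
    f = g := by
  rw [Ideal.Quotient.eq, Ideal.mem_span_singleton] at h
  refine sub_eq_zero.1 (eq_zero_of_dvd_of_natDegree_lt h ?_)
  refine (natDegree_sub_le f g).trans_lt ?_
  rw [hfn, hgn, max_self]
  exact hn

theorem SapC_mk_aux {Fq : Type} [Field Fq] (Q : Fq[X]) (n : ℕ) (hn : n < Q.natDegree)
    (α : Fq[X] → ℂ) {f : Fq[X]} (hf : f.Monic) (hfn : f.natDegree = n) :
    SapC Q n α (Ideal.Quotient.mk (Ideal.span {Q}) f) = α f := by
  have : {g : Fq[X] | g.Monic ∧ g.natDegree = n ∧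
      Ideal.Quotient.mk (Ideal.span {Q}) g = Ideal.Quotient.mk (Ideal.span {Q}) f} = {f} := by
    ext g
    constructor
    · rintro ⟨h1, h2, h3⟩
      exact mk_inj_aux Q n hn h1 h2 hf hfn h3
    · rintro rfl
      exact ⟨hf, hfn, rfl⟩
  rw [SapC, this, finsum_mem_singleton]

theorem var_aux {ι : Type} (U : Finset ι) (hU : 0 < U.card) (s : ι → ℂ) :
    (1 / (U.card : ℝ)) * ∑ a ∈ U, ‖s a - (1 / (U.card : ℂ)) * ∑ b ∈ U, s b‖ ^ 2
      = (1 / (U.card : ℝ)) * ∑ a ∈ U, ‖s a‖ ^ 2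
        - ‖(1 / (U.card : ℂ)) * ∑ b ∈ U, s b‖ ^ 2 := by
  have hc : (U.card : ℝ) ≠ 0 := by positivity
  have hc' : (U.card : ℂ) ≠ 0 := by exact_mod_cast hc
  set m : ℂ := (1 / (U.card : ℂ)) * ∑ b ∈ U, s b with hm
  have hsum : ∑ b ∈ U, s b = U.card * m := by rw [hm]; field_simp
  have hre : ∑ b ∈ U, (s b).re = U.card * m.re := by
    have := congrArg Complex.re hsum
    simpa using this
  have him : ∑ b ∈ U, (s b).im = U.card * m.im := by
    have := congrArg Complex.im hsum
    simpa using this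
  have h : ∀ a, ‖s a - m‖ ^ 2
      = ‖s a‖ ^ 2 - 2 * m.re * (s a).re - 2 * m.im * (s a).im + ‖m‖ ^ 2 := by
    intro a
    simp only [← Complex.normSq_eq_norm_sq, Complex.normSq_apply, Complex.sub_re, Complex.sub_im]
    ring
  simp only [h, Finset.sum_add_distrib, Finset.sum_sub_distrib, ← Finset.mul_sum, hre, him,
    Finset.sum_const, nsmul_eq_mul]
  have h2 : ‖m‖ ^ 2 = m.re * m.re + m.im * m.im := by
    rw [← Complex.normSq_eq_norm_sq, Complex.normSq_apply]
  rw [h2]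
  field_simp
  ring

/-- For `Q` squarefree, `0 ≤ n < deg Q` and `α` even with `|α| ≤ A` on `M_n`,
the variance over invertible residue classes mod `Q` satisfies
`|Var_Q(S_α) − (1/Φ(Q)) ∑_{f ∈ M_n, (f,Q)=1} |α(f)|²| ≤ A²·q^{2n}/Φ(Q)²`. -/
theorem variance_small_n_arithmetic_progressions (Fq : Type) [Field Fq] [Fintype Fq]
    (Q : Fq[X]) (hQ : Squarefree Q) (n : ℕ) (hn : n < Q.natDegree)
    (α : Fq[X] → ℂ) (heven : ∀ (c : Fq), c ≠ 0 → ∀ f : Fq[X], α (C c * f) = α f)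
    (A : ℝ) (hbd : ∀ f : Fq[X], f.Monic → f.natDegree = n → ‖α f‖ ≤ A) :
    |varSapC Q n α
        - (1 / (PhiQ Q : ℝ)) *
            ∑ᶠ f ∈ {f : Fq[X] | f.Monic ∧ f.natDegree = n ∧ IsCoprime f Q},
              ‖α f‖ ^ 2|
      ≤ A ^ 2 * (Fintype.card Fq : ℝ) ^ (2 * n) / (PhiQ Q : ℝ) ^ 2 := by
  classical
  have hQ0 : Q ≠ 0 := by rintro rfl; simp at hn
  haveI : Finite (Fq[X] ⧸ Ideal.span {Q}) := finite_quot_aux Q hQ0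
  obtain ⟨hMfin, hMcard⟩ := monic_aux (Fq := Fq) n
  haveI := Fintype.ofFinite (Fq[X] ⧸ Ideal.span {Q})
  have hM'fin : {f : Fq[X] | f.Monic ∧ f.natDegree = n ∧ IsCoprime f Q}.Finite :=
    hMfin.subset (fun f hf => ⟨hf.1, hf.2.1⟩)
  set M : Finset Fq[X] := hM'fin.toFinset with hM
  have hMmem : ∀ f, f ∈ M ↔ f.Monic ∧ f.natDegree = n ∧ IsCoprime f Q := by
    intro f; simp [hM]
  have hMle : (M.card : ℝ) ≤ (Fintype.card Fq : ℝ) ^ n := by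
    have h1 : M.card ≤ Fintype.card Fq ^ n := by
      rw [hM, ← Set.ncard_eq_toFinset_card _ hM'fin]
      refine le_trans (Set.ncard_le_ncard ?_ hMfin) hMcard
      exact fun f hf => ⟨hf.1, hf.2.1⟩
    exact_mod_cast h1
  set U : Finset (Fq[X] ⧸ Ideal.span {Q}) := Finset.univ.filter IsUnit with hU
  have hUset : {A : Fq[X] ⧸ Ideal.span {Q} | IsUnit A} = ↑U := by ext; simp [hU]
  have hPhi : PhiQ Q = U.card := by rw [PhiQ, hUset, Set.ncard_coe_finset]
  have hUpos : 0 < U.card := Finset.card_pos.mpr ⟨1, by simp [hU]⟩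
  have key : ∀ {R : Type} [AddCommMonoid R] (g : ℂ → R), g 0 = 0 →
      ∑ A ∈ U, g (SapC Q n α A) = ∑ f ∈ M, g (α f) := by
    intro R _ g hg
    have hinj : Set.InjOn (Ideal.Quotient.mk (Ideal.span {Q})) (M : Set Fq[X]) := by
      intro f hf f' hf' h
      have hf1 := (hMmem f).1 hf
      have hf2 := (hMmem f').1 hf'
      exact mk_inj_aux Q n hn hf1.1 hf1.2.1 hf2.1 hf2.2.1 h
    have himg : M.image (Ideal.Quotient.mk (Ideal.span {Q})) ⊆ U := by
      intro a ha
      obtain ⟨f, hf, rfl⟩ := Finset.mem_image.1 ha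
      simpa [hU] using (isUnit_mk_aux Q f).2 ((hMmem f).1 hf).2.2
    rw [← Finset.sum_subset himg, Finset.sum_image hinj]
    · refine Finset.sum_congr rfl fun f hf => ?_
      have hf1 := (hMmem f).1 hf
      rw [SapC_mk_aux Q n hn α hf1.1 hf1.2.1]
    · intro a ha hna
      rw [SapC, finsum_mem_eq_zero_of_forall_eq_zero, hg]
      rintro f ⟨h1, h2, rfl⟩
      refine absurd (Finset.mem_image_of_mem _ ((hMmem f).2 ⟨h1, h2, ?_⟩)) hna
      exact (isUnit_mk_aux Q f).1 (by simpa [hU] using ha)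
  have hmean : meanSapC Q n α = (1 / (U.card : ℂ)) * ∑ A ∈ U, SapC Q n α A := by
    rw [meanSapC, hPhi, hUset, finsum_mem_coe_finset]
  have hs : ∑ᶠ f ∈ {f : Fq[X] | f.Monic ∧ f.natDegree = n ∧ IsCoprime f Q}, ‖α f‖ ^ 2
      = ∑ f ∈ M, ‖α f‖ ^ 2 := finsum_mem_eq_finite_toFinset_sum _ hM'fin
  rw [hs, ← key (fun z => ‖z‖ ^ 2) (by simp), varSapC, hPhi, hUset, finsum_mem_coe_finset,
    hmean, var_aux U hUpos, ← hmean]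
  have hm : ‖meanSapC Q n α‖ ≤ A * (Fintype.card Fq : ℝ) ^ n / U.card := by
    rw [hmean, key (fun z => z) rfl, norm_mul, one_div, norm_inv, Complex.norm_natCast,
      inv_mul_eq_div]
    gcongr
    calc ‖∑ f ∈ M, α f‖ ≤ ∑ f ∈ M, ‖α f‖ := norm_sum_le _ _
      _ ≤ ∑ f ∈ M, A := Finset.sum_le_sum fun f hf =>
          hbd f ((hMmem f).1 hf).1 ((hMmem f).1 hf).2.1
      _ = A * M.card := by simp [mul_comm]
      _ ≤ _ := by
        have hA : 0 ≤ A := (norm_nonneg _).trans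
          (hbd (X ^ n) (monic_X_pow n) (natDegree_X_pow n))
        gcongr
  have h2 : (A * (Fintype.card Fq : ℝ) ^ n / U.card) ^ 2
      = A ^ 2 * (Fintype.card Fq : ℝ) ^ (2 * n) / (U.card : ℝ) ^ 2 := by
    rw [div_pow, mul_pow, ← pow_mul, mul_comm n 2]
  rw [← h2, sub_sub_cancel_left, abs_neg, abs_of_nonneg (by positivity)]
  gcongr
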